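/- Let E be a nonempty demand set whose set of incident nodes splits into c weakly connected components. Then there exists a 2-hop solution for E of length at most |S| + |D| − c, where S and D are the sources and destinations of E. -/

import Mathlib

/-- A demand `(i,j)` is served by schedule `L` along a path of length `ℓ ≥ 1`:
there are flights at increasing positions of `L` forming a path `i = w₀, w₁, …, w_ℓ = j`.
This is encoded by a node list `w` of length `ℓ + 1` whose list of consecutive pairs
is a sublist (ordered subsequence) of `L`. -/
def ServesPath {V : Type*} (L : List (V × V)) (i j : V) (ℓ : ℕ) : Prop :=
  1 ≤ ℓ ∧ ∃ w : List V, w.length = ℓ + 1 ∧ w.head? = some i ∧ w.getLast? = some j ∧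
    (w.zip w.tail).Sublist L

/-- `L` is a multihop solution for the demand set `E`: every demand is served
along a path of some length `ℓ ≥ 1`. -/
def IsMultihopSolution {V : Type*} (L : List (V × V)) (E : Finset (V × V)) : Prop :=
  ∀ p ∈ E, ∃ ℓ, ServesPath L p.1 p.2 ℓ

/-- `L` is a 2-hop solution for the demand set `E`: every demand is served
along a path of length at most 2. -/
def IsTwoHopSolution {V : Type*} (L : List (V × V)) (E : Finset (V × V)) : Prop :=
  ∀ p ∈ E, ∃ ℓ ≤ 2, ServesPath L p.1 p.2 ℓ

/-- Node `v` is incident to some demand of `E`. -/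
def Touches {V : Type*} (E : Finset (V × V)) (v : V) : Prop :=
  ∃ p ∈ E, p.1 = v ∨ p.2 = v

/-- `E` is weakly connected: in the undirected graph on the nodes incident to some
demand, with an edge `{u,v}` whenever `(u,v) ∈ E` or `(v,u) ∈ E`, every two incident
nodes are joined by a path. -/
def WeaklyConnected {V : Type*} (E : Finset (V × V)) : Prop :=
  ∀ u v : V, Touches E u → Touches E v →
    Relation.ReflTransGen (fun a b => (a, b) ∈ E ∨ (b, a) ∈ E) u v

theorem ServesPath.mono {V : Type*} {L L' : List (V × V)} {i j : V} {l : ℕ}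
    (h : ServesPath L i j l) (hL : L.Sublist L') : ServesPath L' i j l := by
  obtain ⟨h1, w, hw, hi, hj, hs⟩ := h
  exact ⟨h1, w, hw, hi, hj, hs.trans hL⟩

theorem servesPath_one {V : Type*} {L : List (V × V)} {i j : V} (h : (i, j) ∈ L) :
    ServesPath L i j 1 :=
  ⟨le_rfl, [i, j], rfl, rfl, rfl, by simpa using h⟩

theorem servesPath_two_append {V : Type*} {L₁ L₂ : List (V × V)} {i k j : V}
    (h₁ : (i, k) ∈ L₁) (h₂ : (k, j) ∈ L₂) : ServesPath (L₁ ++ L₂) i j 2 :=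
  ⟨one_le_two, [i, k, j], rfl, rfl, rfl,
    (List.singleton_sublist.2 h₁).append (List.singleton_sublist.2 h₂)⟩

/-- Routing every demand through a hub that is itself a source saves at least one flight. -/
theorem exists_twoHopSolution_of_nonempty {V : Type*} [DecidableEq V]
    (E : Finset (V × V)) (hE : ∀ p ∈ E, p.1 ≠ p.2) (hne : E.Nonempty) :
    ∃ L : List (V × V), IsTwoHopSolution L E ∧
      L.length + 1 ≤ (E.image Prod.fst).card + (E.image Prod.snd).card := by
  obtain ⟨q, hq⟩ := hne
  have hS : q.1 ∈ E.image Prod.fst := Finset.mem_image_of_mem _ hq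
  refine ⟨((E.image Prod.fst).erase q.1).toList.map (fun i => (i, q.1)) ++
    ((E.image Prod.snd).erase q.1).toList.map (fun j => (q.1, j)), ?_, ?_⟩
  · rintro ⟨i, j⟩ hp
    have hij : i ≠ j := hE _ hp
    have hi : i ∈ E.image Prod.fst := Finset.mem_image_of_mem Prod.fst hp
    have hj : j ∈ E.image Prod.snd := Finset.mem_image_of_mem Prod.snd hp
    have mem_left (h : i ≠ q.1) :
        (i, q.1) ∈ ((E.image Prod.fst).erase q.1).toList.map (fun i => (i, q.1)) :=
      List.mem_map.2 ⟨i, Finset.mem_toList.2 (Finset.mem_erase.2 ⟨h, hi⟩), rfl⟩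
    have mem_right (h : j ≠ q.1) :
        (q.1, j) ∈ ((E.image Prod.snd).erase q.1).toList.map (fun j => (q.1, j)) :=
      List.mem_map.2 ⟨j, Finset.mem_toList.2 (Finset.mem_erase.2 ⟨h, hj⟩), rfl⟩
    by_cases hiq : i = q.1
    · subst hiq
      exact ⟨1, one_le_two, servesPath_one (List.mem_append_right _ (mem_right hij.symm))⟩
    by_cases hjq : j = q.1
    · subst hjq
      exact ⟨1, one_le_two, servesPath_one (List.mem_append_left _ (mem_left hiq))⟩
    exact ⟨2, le_rfl, servesPath_two_append (mem_left hiq) (mem_right hjq)⟩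
  · have h₁ := Finset.card_erase_add_one hS
    have h₂ := Finset.card_erase_le (s := E.image Prod.snd) (a := q.1)
    simp only [List.length_append, List.length_map, Finset.length_toList]
    omega

/-- If a nonempty demand set `E` splits into `c` weakly connected components
(a partition of `E` into nonempty, weakly connected, node-disjoint parts), then
there is a 2-hop solution for `E` of length at most `|S| + |D| − c`. -/
theorem twohop_components_bound {V : Type*} [Fintype V] [DecidableEq V]
    (E : Finset (V × V)) (hE : ∀ p ∈ E, p.1 ≠ p.2) (hne : E.Nonempty)
    (c : ℕ) (P : Fin c → Finset (V × V))
    (hpart : ∀ p : V × V, p ∈ E ↔ ∃ i, p ∈ P i)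
    (hne' : ∀ i, (P i).Nonempty)
    (hconn : ∀ i, WeaklyConnected (P i))
    (hdisj : ∀ i j, i ≠ j → ∀ v : V, Touches (P i) v → ¬ Touches (P j) v) :
    ∃ L : List (V × V), IsTwoHopSolution L E ∧
      L.length ≤ (E.image Prod.fst).card + (E.image Prod.snd).card - c := by
  choose L hL hlen using fun i =>
    exists_twoHopSolution_of_nonempty (P i) (fun p hp => hE p ((hpart p).2 ⟨i, hp⟩)) (hne' i)
  have card_image (f : V × V → V) (hf : ∀ p, p.1 = f p ∨ p.2 = f p) :
      (E.image f).card = ∑ i, ((P i).image f).card := by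
    have hU : E = Finset.univ.biUnion P := by
      ext p
      simp [hpart]
    rw [hU, Finset.biUnion_image, Finset.card_biUnion]
    intro i _ j _ hij
    refine Finset.disjoint_left.2 fun v hi hj => ?_
    obtain ⟨p, hp, rfl⟩ := Finset.mem_image.1 hi
    obtain ⟨p', hp', hpp⟩ := Finset.mem_image.1 hj
    exact hdisj i j hij (f p) ⟨p, hp, hf p⟩ ⟨p', hp', hpp ▸ hf p'⟩
  refine ⟨(List.finRange c).flatMap L, ?_, ?_⟩
  · intro p hp
    obtain ⟨i, hi⟩ := (hpart p).1 hp
    obtain ⟨l, hl, h⟩ := hL i p hi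
    exact ⟨l, hl, h.mono (List.sublist_flatten_of_mem
      (List.mem_map_of_mem (List.mem_finRange i)))⟩
  · have hsum : ((List.finRange c).flatMap L).length = ∑ i, (L i).length := by
      rw [List.length_flatMap, ← List.ofFn_eq_map, List.sum_ofFn]
    have hle := Finset.sum_le_sum fun i (_ : i ∈ Finset.univ) => hlen i
    rw [Finset.sum_add_distrib, Finset.sum_add_distrib, ← card_image _ fun _ => .inl rfl,
      ← card_image _ fun _ => .inr rfl] at hle
    simp only [Finset.sum_const, Finset.card_univ, Fintype.card_fin, smul_eq_mul, mul_one] at hle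
    omega
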